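/- For every s ∈ [0,1] and every base b ≥ 2, there exists an infinite set A ⊆ ℕ such that, with p(x) = x², dim_FS(CE_b(A)) = Dim_FS(CE_b(A)) = dim_FS(CE_b(p(A))) = Dim_FS(CE_b(p(A))) = s. -/

import Mathlib

/-- Number of sliding-block occurrences of `w` in `s`:
`N(w,s) = |{i : s[i…i+|w|−1] = w}|`. -/
def slideN {α : Type*} [DecidableEq α] (w s : List α) : ℕ :=
  ((Finset.range (s.length + 1 - w.length)).filter
    (fun i => ((s.drop i).take w.length) = w)).card

/-- Sliding count probability of `w` in `s`: `P(w,s) = N(w,s)/(|s|−|w|+1)`. -/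
noncomputable def slideP {α : Type*} [DecidableEq α] (w s : List α) : ℝ :=
  (slideN w s : ℝ) / ((s.length : ℝ) - (w.length : ℝ) + 1)

/-- `l`-th sliding block entropy of a string, with logarithms base `|α|`.
The convention `0 · log(1/0) = 0` holds automatically since `Real.logb b 0⁻¹ = 0`. -/
noncomputable def slideH {α : Type*} [Fintype α] [DecidableEq α] (l : ℕ) (x : List α) : ℝ :=
  (1 / (l : ℝ)) * ∑ w : Fin l → α,
    slideP (List.ofFn w) x * Real.logb (Fintype.card α) (slideP (List.ofFn w) x)⁻¹

/-- The prefix `S[0…n]` of a sequence, i.e. its first `n+1` symbols. -/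
def pre {α : Type*} (S : ℕ → α) (n : ℕ) : List α := List.ofFn (fun i : Fin (n + 1) => S i)

/-- Finite-state dimension via sliding block entropies:
`dim_FS(S) = inf_{l ≥ 1} liminf_{n→∞} H_l(S[0…n])`. -/
noncomputable def dimFS {α : Type*} [Fintype α] [DecidableEq α] (S : ℕ → α) : ℝ :=
  ⨅ l : ℕ, Filter.liminf (fun n => slideH (l + 1) (pre S n)) Filter.atTop

/-- Finite-state strong dimension:
`Dim_FS(S) = inf_{l ≥ 1} limsup_{n→∞} H_l(S[0…n])`. -/
noncomputable def DimFS {α : Type*} [Fintype α] [DecidableEq α] (S : ℕ → α) : ℝ :=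
  ⨅ l : ℕ, Filter.limsup (fun n => slideH (l + 1) (pre S n)) Filter.atTop
/-- Cumulative lengths of a sequence of lists. -/
def cumLen {α : Type*} (L : ℕ → List α) : ℕ → ℕ
  | 0 => 0
  | m + 1 => cumLen L m + (L m).length

open scoped Classical in
/-- The infinite sequence obtained by concatenating the lists `L 0, L 1, L 2, …`
(a default symbol is used in the degenerate case where the total length is finite). -/
noncomputable def concatSeq {α : Type*} (dflt : α) (L : ℕ → List α) (k : ℕ) : α :=
  if h : ∃ m, k < cumLen L (m + 1) then
    (L (Nat.find h)).getD (k - cumLen L (Nat.find h)) dflt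
  else dflt
/-- Big-endian base-`b` digit string of `n`, as symbols in `Σ_b = Fin b`. -/
def digitsFin (b : ℕ) (hb : 0 < b) (n : ℕ) : List (Fin b) :=
  (Nat.digits b n).reverse.map (fun d => ⟨d % b, Nat.mod_lt d hb⟩)

/-- The base-`b` Copeland–Erdős sequence `CE_b(A)` of an infinite set `A ⊆ ℕ`:
the concatenation of the base-`b` expansions of the elements of `A` in
increasing order (`Nat.nth (· ∈ A)` enumerates `A` in increasing order). -/
noncomputable def CEseq (b : ℕ) (hb : 0 < b) (A : Set ℕ) : ℕ → Fin b :=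
  concatSeq ⟨0, hb⟩ (fun i => digitsFin b hb (Nat.nth (· ∈ A) i))

/-- The base-`b` Copeland–Erdős sequence `CE_b(f(A))` for `f : ℕ → ℝ`:
the concatenation of the base-`b` expansions of the integer parts `⌊f(n)⌋`
for `n ∈ A` in increasing order of `n`. -/
noncomputable def CEseqF (b : ℕ) (hb : 0 < b) (A : Set ℕ) (f : ℕ → ℝ) : ℕ → Fin b :=
  concatSeq ⟨0, hb⟩ (fun i => digitsFin b hb ⌊f (Nat.nth (· ∈ A) i)⌋₊)


section SlidingCounts

variable {α : Type*} [DecidableEq α]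

lemma slideN_nil {w : List α} (hw : w ≠ []) : slideN w [] = 0 := by
  have : 0 < w.length := List.length_pos_iff.2 hw
  simp [slideN, show 0 + 1 - w.length = 0 by omega]

lemma slideN_cons {w : List α} (hw : w ≠ []) (a : α) (s : List α) :
    slideN w (a :: s) = (if w <+: a :: s then 1 else 0) + slideN w s := by
  have hl : 0 < w.length := List.length_pos_iff.2 hw
  unfold slideN
  by_cases h : w.length ≤ s.length + 1
  · rw [show (a :: s).length + 1 - w.length = (s.length + 1 - w.length) + 1 by
      simp; omega, Finset.card_filter, Finset.card_filter, Finset.sum_range_succ', add_comm]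
    congr 1
    simp [List.prefix_iff_eq_take, eq_comm]
  · have h1 : ¬ w <+: a :: s := fun h' => h (by simpa using h'.length_le)
    rw [if_neg h1, show (a :: s).length + 1 - w.length = 0 by simp; omega,
      show s.length + 1 - w.length = 0 by omega]
    simp

lemma slideN_concat {w : List α} (hw : w ≠ []) (s : List α) (c : α) :
    slideN w (s ++ [c]) = slideN w s + if w <:+ s ++ [c] then 1 else 0 := by
  have hl : 0 < w.length := List.length_pos_iff.2 hw
  unfold slideN
  by_cases h : w.length ≤ s.length + 1
  · rw [show (s ++ [c]).length + 1 - w.length = (s.length + 1 - w.length) + 1 by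
      simp; omega, Finset.card_filter, Finset.card_filter, Finset.sum_range_succ]
    congr 1
    · refine Finset.sum_congr rfl fun i hi => ?_
      rw [Finset.mem_range] at hi
      rw [List.drop_append_of_le_length (by omega), List.take_append_of_le_length]
      simp; omega
    · rw [List.take_of_length_le (by simp; omega)]
      simp [List.suffix_iff_eq_drop, eq_comm]
  · have h1 : ¬ w <:+ s ++ [c] := fun h' => h (by simpa using h'.length_le)
    rw [if_neg h1, show (s ++ [c]).length + 1 - w.length = 0 by simp; omega,
      show s.length + 1 - w.length = 0 by omega]
    simp

lemma slideN_le_length {w : List α} (hw : w ≠ []) (s : List α) : slideN w s ≤ s.length := by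
  have hl : 0 < w.length := List.length_pos_iff.2 hw
  refine (Finset.card_filter_le _ _).trans ?_
  simp; omega

lemma slideN_add_le_append {w : List α} (hw : w ≠ []) (u v : List α) :
    slideN w u + slideN w v ≤ slideN w (u ++ v) := by
  induction u with
  | nil => simp [slideN_nil hw]
  | cons a u ih =>
    rw [List.cons_append, slideN_cons hw, slideN_cons hw]
    by_cases h : w <+: a :: u
    · have h' : w <+: a :: (u ++ v) := h.trans (List.prefix_append (a :: u) v)
      rw [if_pos h, if_pos h']; omega
    · rw [if_neg h]; omega

lemma slideN_append_le {w : List α} (hw : w ≠ []) (u v : List α) :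
    slideN w (u ++ v) ≤ slideN w u + slideN w v + min u.length w.length := by
  induction u with
  | nil => simp [slideN_nil hw]
  | cons a u ih =>
    rw [List.cons_append, slideN_cons hw, slideN_cons hw, List.length_cons]
    by_cases h : w <+: a :: u
    · rw [if_pos h]; split_ifs <;> omega
    · by_cases h' : w <+: a :: (u ++ v)
      · have : ¬ w.length ≤ (a :: u).length := fun hlen =>
          h (List.prefix_of_prefix_length_le h' (List.prefix_append (a :: u) v) hlen)
        rw [List.length_cons] at this
        rw [if_pos h', if_neg h]; omega
      · rw [if_neg h', if_neg h]; omega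

lemma abs_slideN_append_sub_le {w : List α} (hw : w ≠ []) (u v : List α) :
    |(slideN w (u ++ v) : ℝ) - (slideN w u + slideN w v)| ≤ w.length := by
  have h1 : ((slideN w u : ℝ) + slideN w v) ≤ slideN w (u ++ v) := by
    exact_mod_cast slideN_add_le_append hw u v
  have h2 : (slideN w (u ++ v) : ℝ) ≤ slideN w u + slideN w v + w.length := by
    exact_mod_cast (slideN_append_le hw u v).trans (by omega)
  rw [abs_le]
  constructor <;> linarith [(Nat.cast_nonneg w.length : (0 : ℝ) ≤ _)]

lemma slideN_replicate_self (w : List α) (a : α) (z : ℕ) (hwa : w = List.replicate w.length a) :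
    slideN w (List.replicate z a) = z + 1 - w.length := by
  unfold slideN
  rw [Finset.filter_true_of_mem, Finset.card_range, List.length_replicate]
  intro i hi
  simp only [List.length_replicate, Finset.mem_range] at hi
  rw [List.drop_replicate, List.take_replicate, min_eq_left (by omega)]
  exact hwa.symm

lemma slideN_replicate_of_ne (w : List α) (a : α) (z : ℕ) (hwa : w ≠ List.replicate w.length a) :
    slideN w (List.replicate z a) = 0 := by
  unfold slideN
  rw [Finset.card_eq_zero, Finset.filter_eq_empty_iff]
  intro i hi h
  simp only [List.length_replicate, Finset.mem_range] at hi
  rw [List.drop_replicate, List.take_replicate, min_eq_left (by omega)] at h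
  exact hwa h.symm

end SlidingCounts

section Concatenation

variable {α : Type*}

lemma cumLen_mono (L : ℕ → List α) : Monotone (cumLen L) :=
  monotone_nat_of_le_succ fun m => by simp [cumLen]

lemma concatSeq_cumLen_add (d : α) (L : ℕ → List α) (m q : ℕ) (hq : q < (L m).length) :
    concatSeq d L (cumLen L m + q) = (L m)[q] := by
  classical
  have hex : ∃ j, cumLen L m + q < cumLen L (j + 1) := ⟨m, by simp [cumLen, hq]⟩
  have hfind : Nat.find hex = m := by
    rw [Nat.find_eq_iff]
    refine ⟨by simp [cumLen, hq], fun j hj => ?_⟩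
    have := cumLen_mono L (show j + 1 ≤ m from hj)
    omega
  unfold concatSeq
  rw [dif_pos hex]
  have : ∀ j, j = m → (L j).getD (cumLen L m + q - cumLen L j) d = (L m)[q] := by
    rintro j rfl
    simp [List.getD_eq_getElem?_getD, hq]
  apply this
  convert hfind

lemma ofFn_concatSeq_succ (d : α) (L : ℕ → List α) (m : ℕ) :
    List.ofFn (fun i : Fin (cumLen L (m + 1)) => concatSeq d L i) =
      List.ofFn (fun i : Fin (cumLen L m) => concatSeq d L i) ++ L m := by
  have h : List.ofFn (fun i : Fin (cumLen L m + (L m).length) => concatSeq d L i) =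
      List.ofFn (fun i : Fin (cumLen L m) => concatSeq d L i) ++ L m := by
    rw [List.ofFn_add]
    congr 1
    apply List.ext_getElem
    · simp
    · intro q h1 h2
      simp [concatSeq_cumLen_add d L m q h2]
  exact h

lemma abs_slideN_ofFn_concatSeq_sub_le [DecidableEq α] {w : List α} (hw : w ≠ []) (d : α)
    (L : ℕ → List α) (m : ℕ) :
    |(slideN w (List.ofFn (fun i : Fin (cumLen L m) => concatSeq d L i)) : ℝ) -
      ∑ j ∈ Finset.range m, (slideN w (L j) : ℝ)| ≤ m * w.length := by
  induction m with
  | zero => simp [cumLen, slideN_nil hw]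
  | succ m ih =>
    have h := abs_slideN_append_sub_le hw
      (List.ofFn (fun i : Fin (cumLen L m) => concatSeq d L i)) (L m)
    rw [ofFn_concatSeq_succ, Finset.sum_range_succ]
    rw [abs_le] at *
    push_cast
    constructor <;> linarith

lemma abs_slideN_pre_sub_le [DecidableEq α] {w : List α} (hw : w ≠ []) (S : ℕ → α) (n k : ℕ)
    (hk : k ≤ n + 1) :
    |(slideN w (pre S n) : ℝ) - slideN w (List.ofFn (fun i : Fin k => S i))| ≤
      (n + 1 - k) + w.length := by
  obtain ⟨r, hr⟩ := Nat.exists_eq_add_of_le hk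
  have hpre : pre S n = List.ofFn (fun i : Fin k => S i) ++
      List.ofFn (fun i : Fin r => S (k + i)) := by
    have : pre S n = List.ofFn (fun i : Fin (k + r) => S i) := by
      unfold pre; rw [hr]
    rw [this, List.ofFn_add]
    rfl
  have h := abs_slideN_append_sub_le hw (List.ofFn (fun i : Fin k => S i))
    (List.ofFn (fun i : Fin r => S (k + i)))
  have h2 : (slideN w (List.ofFn (fun i : Fin r => S (k + i))) : ℝ) ≤ r := by
    exact_mod_cast (slideN_le_length hw _).trans (by simp)
  have h3 : (n : ℝ) + 1 - k = r := by
    have : (n : ℝ) + 1 = k + r := by exact_mod_cast hr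
    linarith
  have h4 := Nat.cast_nonneg (α := ℝ) (slideN w (List.ofFn (fun i : Fin r => S (k + i))))
  rw [hpre, h3]
  rw [abs_le] at *
  constructor <;> linarith

end Concatenation

section PaddedDigits

/-- The last `k` base-`b` digits of `t`, most significant first, padded with leading zeros. -/
def padDigits (b : ℕ) (hb : 0 < b) : ℕ → ℕ → List (Fin b)
  | 0, _ => []
  | k + 1, t => padDigits b hb k (t / b) ++ [⟨t % b, Nat.mod_lt t hb⟩]

variable {b : ℕ} (hb : 0 < b)

@[simp]
lemma length_padDigits (k t : ℕ) : (padDigits b hb k t).length = k := by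
  induction k generalizing t with
  | zero => rfl
  | succ k ih => simp [padDigits, ih]

lemma padDigits_mod_pow {l j : ℕ} (h : l ≤ j) (t : ℕ) :
    padDigits b hb l (t % b ^ j) = padDigits b hb l t := by
  induction l generalizing t j with
  | zero => rfl
  | succ l ih =>
    obtain ⟨j, rfl⟩ : ∃ i, j = i + 1 := ⟨j - 1, by omega⟩
    have h1 : t % b ^ (j + 1) / b = t / b % b ^ j := by
      rw [pow_succ', Nat.mod_mul_right_div_self]
    have h2 : t % b ^ (j + 1) % b = t % b :=
      Nat.mod_mod_of_dvd t (dvd_pow_self b j.succ_ne_zero)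
    simp only [padDigits, h1, h2, ih (Nat.le_of_succ_le_succ h)]

lemma padDigits_zero (k : ℕ) : padDigits b hb k 0 = List.replicate k ⟨0, hb⟩ := by
  induction k with
  | zero => rfl
  | succ k ih => simp [padDigits, ih, List.replicate_succ']

lemma digitsFin_zero : digitsFin b hb 0 = [] := by simp [digitsFin]

lemma digitsFin_of_pos (hb2 : 2 ≤ b) {n : ℕ} (hn : 0 < n) :
    digitsFin b hb n = digitsFin b hb (n / b) ++ [⟨n % b, Nat.mod_lt n hb⟩] := by
  unfold digitsFin
  rw [Nat.digits_def' hb2 hn]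
  simp

lemma digitsFin_mul_pow_add (hb2 : 2 ≤ b) {a : ℕ} (ha : 0 < a) (k r : ℕ) (hr : r < b ^ k) :
    digitsFin b hb (a * b ^ k + r) = digitsFin b hb a ++ padDigits b hb k r := by
  induction k generalizing r with
  | zero =>
    obtain rfl : r = 0 := by simpa using hr
    simp [padDigits]
  | succ k ih =>
    have h0 : 0 < a * b ^ (k + 1) + r := by positivity
    have h1 : (a * b ^ (k + 1) + r) / b = a * b ^ k + r / b := by
      rw [pow_succ, ← mul_assoc, mul_comm _ b, Nat.mul_add_div hb]
    have h2 : (a * b ^ (k + 1) + r) % b = r % b := by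
      rw [pow_succ, ← mul_assoc, mul_comm _ b, Nat.mul_add_mod]
    rw [digitsFin_of_pos hb hb2 h0]
    simp only [h1, h2, padDigits]
    rw [ih (r / b) (Nat.div_lt_of_lt_mul (by rwa [pow_succ'] at hr)), List.append_assoc]

lemma digitsFin_mul_pow (hb2 : 2 ≤ b) {a : ℕ} (ha : 0 < a) (k : ℕ) :
    digitsFin b hb (a * b ^ k) = digitsFin b hb a ++ List.replicate k ⟨0, hb⟩ := by
  simpa [padDigits_zero] using
    digitsFin_mul_pow_add hb hb2 ha k 0 (by positivity)

lemma length_digitsFin (n : ℕ) : (digitsFin b hb n).length = (Nat.digits b n).length := by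
  simp [digitsFin]

lemma length_digitsFin_le (hb2 : 2 ≤ b) {k n : ℕ} (h : n < b ^ k) :
    (digitsFin b hb n).length ≤ k := by
  rw [length_digitsFin]
  exact (Nat.digits_length_le_iff hb2 n).2 h

lemma lt_length_digitsFin (hb2 : 2 ≤ b) {k n : ℕ} (h : b ^ k ≤ n) :
    k < (digitsFin b hb n).length := by
  rw [length_digitsFin]
  exact (Nat.lt_digits_length_iff hb2 n).2 h

lemma padDigits_eq_replicate_append (hb2 : 2 ≤ b) {k t : ℕ} (ht : t < b ^ k) :
    padDigits b hb k t =
      List.replicate (k - (digitsFin b hb t).length) ⟨0, hb⟩ ++ digitsFin b hb t := by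
  induction k generalizing t with
  | zero =>
    obtain rfl : t = 0 := by simpa using ht
    simp [padDigits, digitsFin_zero]
  | succ k ih =>
    rcases Nat.eq_zero_or_pos t with rfl | h0
    · simp [padDigits_zero, digitsFin_zero]
    · have h1 : t / b < b ^ k := Nat.div_lt_of_lt_mul (by rwa [pow_succ'] at ht)
      rw [padDigits, ih h1, digitsFin_of_pos hb hb2 h0]
      simp

lemma abs_slideN_digitsFin_sub_padDigits_le (hb2 : 2 ≤ b) {w : List (Fin b)} (hw : w ≠ [])
    {k j t : ℕ} (ht : t < b ^ (k + j)) (ht' : b ^ k ≤ t) :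
    |(slideN w (digitsFin b hb t) : ℝ) - slideN w (padDigits b hb (k + j) t)| ≤
      j + w.length := by
  have h1 := lt_length_digitsFin hb hb2 ht'
  have h2 := abs_slideN_append_sub_le hw
    (List.replicate (k + j - (digitsFin b hb t).length) ⟨0, hb⟩) (digitsFin b hb t)
  rw [← padDigits_eq_replicate_append hb hb2 ht] at h2
  have h3 : (slideN w (List.replicate (k + j - (digitsFin b hb t).length) ⟨0, hb⟩) : ℝ) ≤ j := by
    exact_mod_cast (slideN_le_length hw _).trans (by simp; omega)
  have h4 := Nat.cast_nonneg (α := ℝ)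
    (slideN w (List.replicate (k + j - (digitsFin b hb t).length) ⟨0, hb⟩))
  rw [abs_le] at *
  constructor <;> linarith

end PaddedDigits

section SecondMoment

variable {b : ℕ} (hb : 0 < b)

lemma sum_range_mul_mod_div (c d : ℕ) (hc : 0 < c) (f g : ℕ → ℝ) :
    ∑ t ∈ Finset.range (c * d), f (t % c) * g (t / c) =
      (∑ r ∈ Finset.range c, f r) * ∑ q ∈ Finset.range d, g q := by
  rw [Finset.sum_mul_sum, ← Finset.sum_product']
  refine Finset.sum_nbij' (fun t => (t % c, t / c)) (fun p => p.1 + c * p.2) ?_ ?_ ?_ ?_ ?_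
  · intro t ht
    simp only [Finset.mem_range, Finset.mem_product] at ht ⊢
    exact ⟨Nat.mod_lt t hc, Nat.div_lt_of_lt_mul ht⟩
  · rintro ⟨r, q⟩ h
    simp only [Finset.mem_range, Finset.mem_product] at h ⊢
    calc r + c * q < c + c * q := by omega
      _ = c * (q + 1) := by ring
      _ ≤ c * d := Nat.mul_le_mul_left c h.2
  · intro t _
    exact Nat.mod_add_div t c
  · rintro ⟨r, q⟩ h
    simp only [Finset.mem_range, Finset.mem_product] at h
    simp [Nat.add_mul_div_left _ _ hc, Nat.mod_eq_of_lt h.1, Nat.div_eq_of_lt h.1]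
  · intro t _
    rfl

/-- The centred indicator of the event that the last digits of `t` spell `w`. -/
noncomputable def blockDev (w : List (Fin b)) (t : ℕ) : ℝ :=
  (if padDigits b hb w.length t = w then 1 else 0) - ((b : ℝ) ^ w.length)⁻¹

lemma abs_blockDev_le_one (w : List (Fin b)) (t : ℕ) : |blockDev hb w t| ≤ 1 := by
  have h1 : (1 : ℝ) ≤ (b : ℝ) ^ w.length := one_le_pow₀ (by exact_mod_cast hb)
  have h2 := inv_le_one_of_one_le₀ h1
  have h3 : 0 ≤ ((b : ℝ) ^ w.length)⁻¹ := by positivity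
  unfold blockDev
  rw [abs_le]
  split_ifs <;> constructor <;> linarith

lemma sum_indicator_padDigits (w : List (Fin b)) (j : ℕ) :
    ∑ t ∈ Finset.range (b ^ (w.length + j)),
      (if padDigits b hb w.length t = w then (1 : ℝ) else 0) = (b : ℝ) ^ j := by
  induction w using List.reverseRecOn with
  | nil => simp [padDigits]
  | append_singleton w c ih =>
    have h : ∀ t, (if padDigits b hb (w ++ [c]).length t = w ++ [c] then (1 : ℝ) else 0) =
        (if t % b = c then 1 else 0) * (if padDigits b hb w.length (t / b) = w then 1 else 0) := by
      intro t
      rw [List.length_append, List.length_singleton, padDigits, ite_zero_mul_ite_zero, one_mul]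
      congr 1
      refine propext ⟨fun h => ?_, fun h => ?_⟩
      · obtain ⟨h1, h2⟩ := List.append_inj' h rfl
        exact ⟨by simpa [Fin.ext_iff] using h2, h1⟩
      · rw [h.2]
        simp [h.1]
    simp_rw [h]
    rw [List.length_append, List.length_singleton,
      show b ^ (w.length + 1 + j) = b * b ^ (w.length + j) by ring,
      sum_range_mul_mod_div b _ hb (fun r => if r = (c : ℕ) then 1 else 0)
        (fun q => if padDigits b hb w.length q = w then 1 else 0), ih]
    simp [c.isLt]

lemma sum_blockDev (w : List (Fin b)) {m : ℕ} (hm : w.length ≤ m) :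
    ∑ t ∈ Finset.range (b ^ m), blockDev hb w t = 0 := by
  obtain ⟨j, rfl⟩ := Nat.exists_eq_add_of_le hm
  have hb' : (b : ℝ) ≠ 0 := by exact_mod_cast hb.ne'
  unfold blockDev
  rw [Finset.sum_sub_distrib, sum_indicator_padDigits]
  simp only [Finset.sum_const, Finset.card_range, nsmul_eq_mul]
  push_cast
  field_simp
  ring

lemma blockDev_mod_pow_div (w : List (Fin b)) {i j : ℕ} (h : i + w.length ≤ j) (t : ℕ) :
    blockDev hb w (t % b ^ j / b ^ i) = blockDev hb w (t / b ^ i) := by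
  obtain ⟨r, rfl⟩ : ∃ r, j = i + r := ⟨j - i, by omega⟩
  rw [pow_add, Nat.mod_mul_right_div_self]
  unfold blockDev
  rw [padDigits_mod_pow hb (by omega)]

lemma sum_blockDev_mul_blockDev (w : List (Fin b)) {i j k : ℕ} (hij : i + w.length ≤ j)
    (hjk : j + w.length ≤ k) :
    ∑ t ∈ Finset.range (b ^ k), blockDev hb w (t / b ^ i) * blockDev hb w (t / b ^ j) = 0 := by
  obtain ⟨r, rfl⟩ : ∃ r, k = j + r := ⟨k - j, by omega⟩
  rw [← mul_zero (∑ r ∈ Finset.range (b ^ j), blockDev hb w (r / b ^ i)),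
    ← sum_blockDev hb w (show w.length ≤ r by omega),
    ← sum_range_mul_mod_div _ _ (by positivity) (fun r => blockDev hb w (r / b ^ i)), ← pow_add]
  exact Finset.sum_congr rfl fun t _ => by rw [blockDev_mod_pow_div hb w hij]

/-- The deviation of the number of occurrences of `w` among the last `k` digits of `t` from its
average over all `t < b ^ k`. -/
noncomputable def countDev (w : List (Fin b)) (k t : ℕ) : ℝ :=
  ∑ i ∈ Finset.range (k + 1 - w.length), blockDev hb w (t / b ^ i)

lemma slideN_padDigits {w : List (Fin b)} (hw : w ≠ []) (k t : ℕ) :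
    (slideN w (padDigits b hb k t) : ℝ) = ∑ i ∈ Finset.range (k + 1 - w.length),
      if padDigits b hb w.length (t / b ^ i) = w then (1 : ℝ) else 0 := by
  have hl : 0 < w.length := List.length_pos_iff.2 hw
  induction k generalizing t with
  | zero => simp [padDigits, slideN_nil hw, show 0 + 1 - w.length = 0 by omega]
  | succ k ih =>
    have hcond : w <:+ padDigits b hb (k + 1) t ↔
        w.length ≤ k + 1 ∧ padDigits b hb w.length t = w := by
      have key : ∀ l ≤ k + 1, padDigits b hb l t <:+ padDigits b hb (k + 1) t := by
        clear ih
        generalize k + 1 = K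
        intro l hl
        induction l generalizing t K with
        | zero => simp [padDigits]
        | succ l ihl =>
          obtain ⟨K, rfl⟩ : ∃ i, K = i + 1 := ⟨K - 1, by omega⟩
          obtain ⟨u, hu⟩ := ihl (t / b) K (by omega)
          exact ⟨u, by rw [padDigits, padDigits, ← hu, List.append_assoc]⟩
      constructor
      · intro h
        have hle : w.length ≤ k + 1 := by simpa using h.length_le
        refine ⟨hle, ?_⟩
        exact (List.suffix_of_suffix_length_le (key _ hle) h (by simp)).eq_of_length (by simp)
      · rintro ⟨hle, h⟩
        rw [← h]
        exact key _ hle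
    have hstep : (slideN w (padDigits b hb (k + 1) t) : ℝ) =
        slideN w (padDigits b hb k (t / b)) +
          if w.length ≤ k + 1 ∧ padDigits b hb w.length t = w then (1 : ℝ) else 0 := by
      simp only [← hcond]
      rw [padDigits, slideN_concat hw]
      push_cast
      rfl
    rw [hstep, ih]
    by_cases hle : w.length ≤ k + 1
    · rw [show k + 1 + 1 - w.length = (k + 1 - w.length) + 1 by omega, Finset.sum_range_succ']
      simp [hle, Nat.div_div_eq_div_mul, pow_succ']
    · simp [hle, show k + 1 + 1 - w.length = 0 by omega, show k + 1 - w.length = 0 by omega]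

lemma slideN_padDigits_eq {w : List (Fin b)} (hw : w ≠ []) (k t : ℕ) :
    (slideN w (padDigits b hb k t) : ℝ) =
      countDev hb w k t + (k + 1 - w.length : ℕ) * ((b : ℝ) ^ w.length)⁻¹ := by
  rw [slideN_padDigits hb hw, countDev]
  simp [blockDev, Finset.sum_sub_distrib]

lemma sum_sq_countDev_le (w : List (Fin b)) (hw : w ≠ []) (k : ℕ) :
    ∑ t ∈ Finset.range (b ^ k), countDev hb w k t ^ 2 ≤ 2 * w.length * k * (b : ℝ) ^ k := by
  have hl : 0 < w.length := List.length_pos_iff.2 hw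
  set R := Finset.range (k + 1 - w.length) with hR
  have hpair : ∀ i ∈ R, ∀ j ∈ R,
      ∑ t ∈ Finset.range (b ^ k), blockDev hb w (t / b ^ i) * blockDev hb w (t / b ^ j) ≤
        if j ∈ Finset.Ico (i + 1 - w.length) (i + w.length) then (b : ℝ) ^ k else 0 := by
    intro i hi j hj
    rw [hR, Finset.mem_range] at hi hj
    split_ifs with h
    · calc _ ≤ ∑ t ∈ Finset.range (b ^ k), (1 : ℝ) := by
            refine Finset.sum_le_sum fun t _ => ?_
            refine (le_abs_self _).trans ?_
            rw [abs_mul]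
            exact mul_le_one₀ (abs_blockDev_le_one hb w _) (abs_nonneg _)
              (abs_blockDev_le_one hb w _)
        _ = (b : ℝ) ^ k := by simp
    · rw [Finset.mem_Ico, not_and_or, not_le, not_lt] at h
      rcases h with h | h
      · refine le_of_eq ?_
        rw [← sum_blockDev_mul_blockDev hb w (i := j) (j := i) (k := k) (by omega) (by omega)]
        exact Finset.sum_congr rfl fun t _ => mul_comm _ _
      · exact (sum_blockDev_mul_blockDev hb w h (by omega)).le
  have hexp : ∑ t ∈ Finset.range (b ^ k), countDev hb w k t ^ 2 = ∑ i ∈ R, ∑ j ∈ R,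
      ∑ t ∈ Finset.range (b ^ k), blockDev hb w (t / b ^ i) * blockDev hb w (t / b ^ j) := by
    simp_rw [countDev, sq, Finset.sum_mul_sum]
    rw [Finset.sum_comm]
    exact Finset.sum_congr rfl fun i _ => Finset.sum_comm
  rw [hexp]
  calc _ ≤ ∑ i ∈ R, ∑ j ∈ R,
        if j ∈ Finset.Ico (i + 1 - w.length) (i + w.length) then (b : ℝ) ^ k else 0 :=
        Finset.sum_le_sum fun i hi => Finset.sum_le_sum fun j hj => hpair i hi j hj
    _ ≤ ∑ i ∈ R, 2 * w.length * (b : ℝ) ^ k := by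
        refine Finset.sum_le_sum fun i _ => ?_
        rw [← Finset.sum_filter, Finset.sum_const, nsmul_eq_mul]
        refine mul_le_mul_of_nonneg_right ?_ (by positivity)
        have : (R.filter fun j => j ∈ Finset.Ico (i + 1 - w.length) (i + w.length)).card ≤
            2 * w.length := by
          refine (Finset.card_le_card fun j hj => (Finset.mem_filter.1 hj).2).trans ?_
          rw [Nat.card_Ico]; omega
        exact_mod_cast this
    _ ≤ 2 * w.length * k * (b : ℝ) ^ k := by
        rw [Finset.sum_const, nsmul_eq_mul, hR, Finset.card_range]
        have : ((k + 1 - w.length : ℕ) : ℝ) ≤ k := by exact_mod_cast (by omega)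
        calc _ ≤ (k : ℝ) * (2 * w.length * (b : ℝ) ^ k) := by gcongr
          _ = _ := by ring

end SecondMoment

section SquareConstruction

variable {b : ℕ} (hb : 0 < b)

lemma countDev_eq_zero_of_lt (w : List (Fin b)) {k : ℕ} (h : k < w.length) (t : ℕ) :
    countDev hb w k t = 0 := by
  simp [countDev, show k + 1 - w.length = 0 by omega]

/-- A weighted sum of the squared deviations `countDev` over all nonempty words. -/
noncomputable def discrepancy (k t : ℕ) : ℝ :=
  ∑ l ∈ Finset.range k, ∑ v : Fin (l + 1) → Fin b,
    ((2 * b : ℝ) ^ (l + 1) * (2 * (l + 1)))⁻¹ * countDev hb (List.ofFn v) k t ^ 2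

lemma discrepancy_nonneg (k t : ℕ) : 0 ≤ discrepancy hb k t :=
  Finset.sum_nonneg fun _ _ => Finset.sum_nonneg fun _ _ => by positivity

lemma sq_countDev_le_discrepancy {w : List (Fin b)} (hw : w ≠ []) (k t : ℕ) :
    countDev hb w k t ^ 2 ≤ (2 * b : ℝ) ^ w.length * (2 * w.length) * discrepancy hb k t := by
  have hb' : (0 : ℝ) < b := by exact_mod_cast hb
  have hl : 0 < w.length := List.length_pos_iff.2 hw
  by_cases hk : k < w.length
  · rw [countDev_eq_zero_of_lt hb w hk]
    have := discrepancy_nonneg hb k t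
    rw [zero_pow two_ne_zero]
    positivity
  obtain ⟨l, hl'⟩ : ∃ l, w.length = l + 1 := ⟨w.length - 1, by omega⟩
  obtain ⟨v, rfl⟩ : ∃ v : Fin (l + 1) → Fin b, w = List.ofFn v := by
    exact ⟨fun i => w[i], List.ext_getElem (by rw [List.length_ofFn, hl'])
      fun i _ _ => by rw [List.getElem_ofFn]; rfl⟩
  have h1 : ((2 * b : ℝ) ^ (l + 1) * (2 * (l + 1)))⁻¹ * countDev hb (List.ofFn v) k t ^ 2 ≤
      discrepancy hb k t := by
    unfold discrepancy
    refine le_trans ?_ (Finset.single_le_sum (f := fun l => ∑ v : Fin (l + 1) → Fin b,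
      ((2 * b : ℝ) ^ (l + 1) * (2 * (l + 1)))⁻¹ * countDev hb (List.ofFn v) k t ^ 2)
      (fun _ _ => Finset.sum_nonneg fun _ _ => by positivity)
      (Finset.mem_range.2 (show l < k by omega)))
    exact Finset.single_le_sum (f := fun v : Fin (l + 1) → Fin b =>
      ((2 * b : ℝ) ^ (l + 1) * (2 * (l + 1)))⁻¹ * countDev hb (List.ofFn v) k t ^ 2)
      (fun _ _ => by positivity) (Finset.mem_univ v)
  rw [inv_mul_le_iff₀ (by positivity)] at h1
  simpa using h1

lemma sum_discrepancy_le (k : ℕ) :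
    ∑ t ∈ Finset.range (b ^ k), discrepancy hb k t ≤ k * (b : ℝ) ^ k := by
  have hb' : (0 : ℝ) < b := by exact_mod_cast hb
  unfold discrepancy
  rw [Finset.sum_comm]
  have hword : ∀ l ∈ Finset.range k, ∑ t ∈ Finset.range (b ^ k), ∑ v : Fin (l + 1) → Fin b,
      ((2 * b : ℝ) ^ (l + 1) * (2 * (l + 1)))⁻¹ * countDev hb (List.ofFn v) k t ^ 2 ≤
        (1 / 2 / 2 ^ l) * (k * (b : ℝ) ^ k) := by
    intro l _
    rw [Finset.sum_comm]
    calc _ ≤ ∑ v : Fin (l + 1) → Fin b, ((2 * b : ℝ) ^ (l + 1) * (2 * (l + 1)))⁻¹ *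
          (2 * (l + 1) * k * (b : ℝ) ^ k) := by
          refine Finset.sum_le_sum fun v _ => ?_
          rw [← Finset.mul_sum]
          refine mul_le_mul_of_nonneg_left ?_ (by positivity)
          simpa using sum_sq_countDev_le hb (List.ofFn v) (by simp) k
      _ = (1 / 2 / 2 ^ l) * (k * (b : ℝ) ^ k) := by
          simp only [Finset.sum_const, Finset.card_univ, Fintype.card_fun, Fintype.card_fin,
            nsmul_eq_mul, mul_pow]
          push_cast
          field_simp
          ring
  refine (Finset.sum_le_sum hword).trans ?_
  rw [← Finset.sum_mul]
  refine mul_le_of_le_one_left (by positivity) ?_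
  refine (Summable.sum_le_tsum _ (fun _ _ => by positivity) (summable_geometric_two' 1)).trans ?_
  rw [tsum_geometric_two']

lemma exists_sum_discrepancy_le (m r : ℕ) (f : Fin 3 → ℕ → ℕ)
    (hmaps : ∀ i, ∀ y < b ^ m, f i y < b ^ (m + r))
    (hinj : ∀ i, ∀ y < b ^ m, ∀ y' < b ^ m, f i y = f i y' → y = y') :
    ∃ y < b ^ m, ∑ i, discrepancy hb (m + r) (f i y) ≤ 3 * ((m + r : ℕ) * (b : ℝ) ^ r) := by
  have hb' : (0 : ℝ) < b := by exact_mod_cast hb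
  have hne : (Finset.range (b ^ m)).Nonempty := ⟨0, Finset.mem_range.2 (by positivity)⟩
  obtain ⟨y, hy, h⟩ := Finset.exists_le_of_sum_le (s := Finset.range (b ^ m))
    (f := fun y => ∑ i, discrepancy hb (m + r) (f i y))
    (g := fun _ => 3 * ((m + r : ℕ) * (b : ℝ) ^ r)) hne (by
      rw [Finset.sum_comm]
      calc _ ≤ ∑ _i : Fin 3, (m + r : ℕ) * (b : ℝ) ^ (m + r) := by
            refine Finset.sum_le_sum fun i _ => ?_
            refine le_trans ?_ (sum_discrepancy_le hb (m + r))
            rw [← Finset.sum_image (g := f i) (f := discrepancy hb (m + r))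
              fun y hy y' hy' => hinj i y (by simpa using hy) y' (by simpa using hy')]
            refine Finset.sum_le_sum_of_subset_of_nonneg ?_
              fun _ _ _ => discrepancy_nonneg hb _ _
            intro t ht
            obtain ⟨y, hy, rfl⟩ := Finset.mem_image.1 ht
            exact Finset.mem_range.2 (hmaps i y (Finset.mem_range.1 hy))
        _ = _ := by
            simp only [Finset.sum_const, Finset.card_univ, Fintype.card_fin, Finset.card_range,
              nsmul_eq_mul]
            push_cast
            ring)
  exact ⟨y, Finset.mem_range.1 hy, h⟩

lemma pow_dvd_two_mul_of_dvd_mul {b k : ℕ} {u Z : ℤ}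
    (h : (b : ℤ) ^ k ∣ u * (2 + (b : ℤ) ^ 2 * Z)) : (b : ℤ) ^ k ∣ 2 * u := by
  rcases Nat.even_or_odd' b with ⟨a, ha | ha⟩
  · have hcop : IsCoprime ((b : ℤ) ^ k) (1 + b * (a * Z)) :=
      IsCoprime.pow_left ⟨-(a * Z), 1, by ring⟩
    refine hcop.dvd_of_dvd_mul_right ?_
    have : u * (2 + (b : ℤ) ^ 2 * Z) = 2 * u * (1 + b * (a * Z)) := by
      rw [ha]; push_cast; ring
    rwa [this] at h
  · have hcop : IsCoprime ((b : ℤ) ^ k) (2 + (b : ℤ) ^ 2 * Z) :=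
      IsCoprime.pow_left ⟨1 + a * b * Z, -a, by rw [ha]; push_cast; ring⟩
    exact (hcop.dvd_of_dvd_mul_right h).mul_left 2

lemma squareSeed_mod_injective (hb2 : 2 ≤ b) (m : ℕ) {y y' : ℕ} (hy : y < b ^ m) (hy' : y' < b ^ m)
    (h : (b ^ (m + 2) + b ^ 2 * y + 1) ^ 2 % b ^ (m + 3) =
      (b ^ (m + 2) + b ^ 2 * y' + 1) ^ 2 % b ^ (m + 3)) : y = y' := by
  have hd := (Nat.modEq_iff_dvd.1 (show _ ≡ _ [MOD b ^ (m + 3)] from h))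
  push_cast at hd
  have h2 : (b : ℤ) ^ (m + 3) ∣ 2 * ((b : ℤ) ^ 2 * (y' - y)) := by
    refine pow_dvd_two_mul_of_dvd_mul (Z := 2 * (b : ℤ) ^ m + y + y') ?_
    convert hd using 1
    ring
  have hbz : (2 : ℤ) ≤ b := by exact_mod_cast hb2
  have h3 : (b : ℤ) ^ (m + 1) ∣ 2 * (y' - y) := by
    rw [show (b : ℤ) ^ (m + 3) = (b : ℤ) ^ 2 * (b : ℤ) ^ (m + 1) by ring,
      show 2 * ((b : ℤ) ^ 2 * ((y' : ℤ) - y)) = (b : ℤ) ^ 2 * (2 * (y' - y)) by ring] at h2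
    exact (mul_dvd_mul_iff_left (by positivity)).1 h2
  have hyz : (y : ℤ) < (b : ℤ) ^ m := by exact_mod_cast hy
  have hyz' : (y' : ℤ) < (b : ℤ) ^ m := by exact_mod_cast hy'
  have h4 : |2 * ((y' : ℤ) - y)| < (b : ℤ) ^ (m + 1) := by
    have : 2 * (b : ℤ) ^ m ≤ (b : ℤ) ^ (m + 1) := by
      rw [pow_succ']
      exact mul_le_mul_of_nonneg_right hbz (by positivity)
    rw [abs_lt]
    constructor <;> omega
  have := Int.eq_zero_of_abs_lt_dvd h3 h4
  omega

lemma squareSeed_div_lt_div (hb2 : 2 ≤ b) (m : ℕ) {y y' : ℕ} (h : y < y') :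
    (b ^ (m + 2) + b ^ 2 * y + 1) ^ 2 / b ^ (m + 3) <
      (b ^ (m + 2) + b ^ 2 * y' + 1) ^ 2 / b ^ (m + 3) := by
  have hpos : 0 < b ^ (m + 3) := by positivity
  rw [← Nat.succ_le_iff, Nat.le_div_iff_mul_le hpos, Nat.succ_eq_add_one, add_mul, one_mul]
  have h1 := Nat.div_mul_le_self ((b ^ (m + 2) + b ^ 2 * y + 1) ^ 2) (b ^ (m + 3))
  refine (Nat.add_le_add_right h1 _).trans ?_
  obtain ⟨c, rfl⟩ := Nat.exists_eq_add_of_lt h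
  have h2 : b ^ (m + 3) ≤ 2 * b ^ (m + 2) * (b ^ 2 * (c + 1)) := by
    calc b ^ (m + 3) = b ^ (m + 2) * (b * 1) := by ring
      _ ≤ b ^ (m + 2) * (b * (2 * b * (c + 1))) := by
          gcongr
          exact Nat.succ_le_of_lt (by positivity)
      _ = _ := by ring
  calc _ ≤ (b ^ (m + 2) + b ^ 2 * y + 1) ^ 2 + 2 * b ^ (m + 2) * (b ^ 2 * (c + 1)) := by gcongr
    _ ≤ (b ^ (m + 2) + b ^ 2 * y + 1) ^ 2 + 2 * (b ^ (m + 2) + b ^ 2 * y + 1) * (b ^ 2 * (c + 1))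
          + (b ^ 2 * (c + 1)) ^ 2 := by
        refine le_trans ?_ (Nat.le_add_right _ _)
        gcongr
        omega
    _ = _ := by ring

lemma squareSeed_lt (hb2 : 2 ≤ b) (m : ℕ) {y : ℕ} (hy : y < b ^ m) :
    b ^ (m + 2) + b ^ 2 * y + 1 < b ^ (m + 3) := by
  have h1 : b ^ 2 * (y + 1) ≤ b ^ 2 * b ^ m := Nat.mul_le_mul_left _ hy
  have h2 : 2 * b ^ (m + 2) ≤ b ^ (m + 3) := by
    rw [pow_succ' b (m + 2)]
    exact Nat.mul_le_mul_right _ hb2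
  have h3 : 2 * 2 ≤ b ^ 2 := by rw [sq]; exact Nat.mul_le_mul hb2 hb2
  have h4 : b ^ 2 * b ^ m = b ^ (m + 2) := by ring
  rw [mul_add] at h1
  omega

/-- There are `m + 3`-digit numbers all of whose digit blocks, as well as those of both halves of
their squares, have deviations of square-root size. -/
lemma exists_sq_countDev_le (hb2 : 2 ≤ b) (m : ℕ) :
    ∃ x, b ^ (m + 2) ≤ x ∧ x < b ^ (m + 3) ∧ ∀ w : List (Fin b), w ≠ [] →
      ∀ t ∈ ({x, x ^ 2 % b ^ (m + 3), x ^ 2 / b ^ (m + 3)} : Set ℕ),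
        countDev hb w (m + 3) t ^ 2 ≤
          (2 * b : ℝ) ^ w.length * (2 * w.length) * (3 * ((m + 3 : ℕ) * (b : ℝ) ^ 3)) := by
  have hpos : 0 < b ^ (m + 3) := by positivity
  obtain ⟨y, hy, h⟩ := exists_sum_discrepancy_le hb m 3
    ![fun y => b ^ (m + 2) + b ^ 2 * y + 1,
      fun y => (b ^ (m + 2) + b ^ 2 * y + 1) ^ 2 % b ^ (m + 3),
      fun y => (b ^ (m + 2) + b ^ 2 * y + 1) ^ 2 / b ^ (m + 3)]
    (by
      intro i y hy
      fin_cases i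
      · exact squareSeed_lt hb2 m hy
      · exact Nat.mod_lt _ hpos
      · refine Nat.div_lt_of_lt_mul ?_
        rw [← sq]
        exact Nat.pow_lt_pow_left (squareSeed_lt hb2 m hy) two_ne_zero)
    (by
      intro i y hy y' hy' heq
      fin_cases i
      · have : b ^ 2 * y = b ^ 2 * y' := by simpa using heq
        exact Nat.eq_of_mul_eq_mul_left (by positivity) this
      · exact squareSeed_mod_injective hb2 m hy hy' heq
      · by_contra hne
        rcases Nat.lt_or_gt_of_ne hne with hlt | hlt
        · exact (squareSeed_div_lt_div hb2 m hlt).ne heq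
        · exact (squareSeed_div_lt_div hb2 m hlt).ne' heq)
  refine ⟨b ^ (m + 2) + b ^ 2 * y + 1, by omega, squareSeed_lt hb2 m hy, fun w hw t ht => ?_⟩
  refine (sq_countDev_le_discrepancy hb hw _ _).trans ?_
  refine mul_le_mul_of_nonneg_left ?_ (by positivity)
  refine le_trans ?_ h
  rw [Fin.sum_univ_three]
  have h0 := fun t => discrepancy_nonneg hb (m + 3) t
  simp only [Matrix.cons_val]
  rcases ht with rfl | rfl | rfl <;> linarith [h0 (b ^ (m + 2) + b ^ 2 * y + 1),
    h0 ((b ^ (m + 2) + b ^ 2 * y + 1) ^ 2 % b ^ (m + 3)),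
    h0 ((b ^ (m + 2) + b ^ 2 * y + 1) ^ 2 / b ^ (m + 3))]

lemma abs_slideN_padDigits_sub_le {w : List (Fin b)} (hw : w ≠ []) (k t : ℕ) :
    |(slideN w (padDigits b hb k t) : ℝ) - k * ((b : ℝ) ^ w.length)⁻¹| ≤
      |countDev hb w k t| + w.length := by
  have hl : 0 < w.length := List.length_pos_iff.2 hw
  have h1 : (1 : ℝ) ≤ (b : ℝ) ^ w.length := one_le_pow₀ (by exact_mod_cast hb)
  have h2 := inv_le_one_of_one_le₀ h1
  have h3 : 0 ≤ ((b : ℝ) ^ w.length)⁻¹ := by positivity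
  have h4 : (k : ℝ) ≤ (k + 1 - w.length : ℕ) + w.length := by
    exact_mod_cast (by omega)
  have h5 : ((k + 1 - w.length : ℕ) : ℝ) ≤ k := by
    exact_mod_cast (by omega)
  rw [slideN_padDigits_eq hb hw, add_sub_assoc, ← sub_mul]
  refine (abs_add_le _ _).trans (add_le_add_right ?_ _)
  rw [abs_mul, abs_of_nonneg h3, abs_of_nonpos (by linarith)]
  exact (mul_le_of_le_one_right (by linarith) h2).trans (by linarith)

/-- A sequence of numbers which are asymptotically normal together with their squares. -/
lemma exists_normal_and_sq_normal (hb2 : 2 ≤ b) :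
    ∃ X : ℕ → ℕ, (∀ m, b ^ (m + 2) ≤ X m ∧ X m < b ^ (m + 3)) ∧
      ∀ w : List (Fin b), w ≠ [] → ∃ C : ℝ, 0 ≤ C ∧ ∀ m : ℕ,
        |(slideN w (digitsFin b hb (X m)) : ℝ) - m * ((b : ℝ) ^ w.length)⁻¹| ≤ C * √(m + 1) ∧
        |(slideN w (digitsFin b hb (X m ^ 2)) : ℝ) - 2 * m * ((b : ℝ) ^ w.length)⁻¹| ≤
          C * √(m + 1) := by
  choose X hX1 hX2 hX using exists_sq_countDev_le hb hb2
  refine ⟨X, fun m => ⟨hX1 m, hX2 m⟩, fun w hw => ?_⟩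
  set c : ℝ := (2 * b : ℝ) ^ w.length * (2 * w.length) * (9 * (b : ℝ) ^ 3) with hc
  have hc0 : 0 ≤ c := by positivity
  refine ⟨2 * √c + 4 * w.length + 12, by positivity, fun m => ?_⟩
  set q : ℝ := ((b : ℝ) ^ w.length)⁻¹ with hq
  have hq0 : 0 ≤ q := by positivity
  have hq1 : q ≤ 1 := inv_le_one_of_one_le₀ (one_le_pow₀ (by exact_mod_cast hb))
  have hs1 : 1 ≤ √((m : ℝ) + 1) := Real.one_le_sqrt.2 (by
    linarith [(Nat.cast_nonneg m : (0 : ℝ) ≤ m)])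
  have hdev : ∀ t ∈ ({X m, X m ^ 2 % b ^ (m + 3), X m ^ 2 / b ^ (m + 3)} : Set ℕ),
      |(slideN w (padDigits b hb (m + 3) t) : ℝ) - (m + 3 : ℕ) * q| ≤
        √c * √(m + 1) + w.length := by
    intro t ht
    refine (abs_slideN_padDigits_sub_le hb hw (m + 3) t).trans (add_le_add_left ?_ _)
    rw [← Real.sqrt_mul hc0]
    refine Real.abs_le_sqrt ((hX m w hw t ht).trans ?_)
    have : ((m + 3 : ℕ) : ℝ) ≤ 3 * (m + 1) := by
      push_cast
      linarith [(Nat.cast_nonneg m : (0 : ℝ) ≤ m)]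
    calc _ ≤ (2 * b : ℝ) ^ w.length * (2 * w.length) * (3 * ((3 * (m + 1)) * (b : ℝ) ^ 3)) := by
          gcongr
      _ = c * (m + 1) := by rw [hc]; ring
  have hxdev := hdev (X m) (by simp)
  have hRdev := hdev (X m ^ 2 % b ^ (m + 3)) (by simp)
  have hTdev := hdev (X m ^ 2 / b ^ (m + 3)) (by simp)
  have hx := abs_slideN_digitsFin_sub_padDigits_le hb hb2 hw (k := m + 2) (j := 1) (hX2 m) (hX1 m)
  have hT0 : b ^ (m + 1) ≤ X m ^ 2 / b ^ (m + 3) := by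
    rw [Nat.le_div_iff_mul_le (by positivity)]
    calc b ^ (m + 1) * b ^ (m + 3) = (b ^ (m + 2)) ^ 2 := by ring
      _ ≤ X m ^ 2 := Nat.pow_le_pow_left (hX1 m) 2
  have hT1 : X m ^ 2 / b ^ (m + 3) < b ^ (m + 1 + 2) := by
    refine Nat.div_lt_of_lt_mul ?_
    calc X m ^ 2 < (b ^ (m + 3)) ^ 2 := Nat.pow_lt_pow_left (hX2 m) two_ne_zero
      _ = _ := by ring
  have hT := abs_slideN_digitsFin_sub_padDigits_le hb hb2 hw hT1 hT0
  have happ := abs_slideN_append_sub_le hw (digitsFin b hb (X m ^ 2 / b ^ (m + 3)))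
    (padDigits b hb (m + 3) (X m ^ 2 % b ^ (m + 3)))
  rw [← digitsFin_mul_pow_add hb hb2 (lt_of_lt_of_le (by positivity) hT0) _ _
    (Nat.mod_lt _ (by positivity)), Nat.div_add_mod'] at happ
  have hl1 : (w.length : ℝ) ≤ w.length * √(m + 1) :=
    le_mul_of_one_le_right (by positivity) hs1
  have hcs : 0 ≤ √c * √((m : ℝ) + 1) := by positivity
  have hring : (2 * √c + 4 * w.length + 12) * √((m : ℝ) + 1) =
      2 * (√c * √(m + 1)) + 4 * (w.length * √(m + 1)) + 12 * √(m + 1) := by ring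
  push_cast at *
  rw [hring]
  simp only [abs_le] at *
  refine ⟨⟨?_, ?_⟩, ?_, ?_⟩ <;> linarith

end SquareConstruction

section Frequencies

open Filter Topology

variable {α : Type*}

lemma abs_cumLen_sub_le (L : ℕ → List α) {a C : ℝ}
    (hlen : ∀ m : ℕ, |((L m).length : ℝ) - a * m| ≤ C) (m : ℕ) :
    |(cumLen L m : ℝ) - a * (m * (m - 1) / 2)| ≤ C * m := by
  induction m with
  | zero => simp [cumLen]
  | succ m ih =>
    have h := hlen m
    simp only [cumLen]
    push_cast
    rw [abs_le] at *
    constructor <;> linarith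

lemma abs_sum_sub_le {f : ℕ → ℝ} {a C : ℝ} (hC : 0 ≤ C)
    (hf : ∀ m : ℕ, |f m - a * m| ≤ C * √(m + 1)) (m : ℕ) :
    |∑ j ∈ Finset.range m, f j - a * (m * (m - 1) / 2)| ≤ C * (m * √(m + 1)) := by
  induction m with
  | zero => simp
  | succ m ih =>
    have h := hf m
    have h1 : √((m : ℝ) + 1) ≤ √(((m + 1 : ℕ) : ℝ) + 1) := Real.sqrt_le_sqrt (by push_cast; linarith)
    have h2 : C * (m * √((m : ℝ) + 1)) + C * √((m : ℝ) + 1) ≤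
        C * ((m + 1 : ℕ) * √(((m + 1 : ℕ) : ℝ) + 1)) := by
      calc _ = C * ((m + 1 : ℕ) * √((m : ℝ) + 1)) := by push_cast; ring
        _ ≤ _ := by gcongr
    rw [Finset.sum_range_succ]
    refine le_trans ?_ h2
    rw [abs_le] at *
    push_cast
    constructor <;> linarith

lemma eventually_sq_le_cumLen (L : ℕ → List α) {a C : ℝ} (ha : 0 < a)
    (hlen : ∀ m : ℕ, |((L m).length : ℝ) - a * m| ≤ C) :
    ∀ᶠ m : ℕ in atTop, a / 4 * ((m : ℝ) + 1) ^ 2 ≤ cumLen L m := by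
  filter_upwards [tendsto_natCast_atTop_atTop.eventually_ge_atTop ((5 * a + 4 * C) / a),
    eventually_ge_atTop 1] with m hm hm1
  have hm1' : (1 : ℝ) ≤ m := by exact_mod_cast hm1
  have h := (abs_le.1 (abs_cumLen_sub_le L hlen m)).1
  rw [div_le_iff₀ ha] at hm
  nlinarith

lemma tendsto_cumLen_atTop (L : ℕ → List α) {a C : ℝ} (ha : 0 < a)
    (hlen : ∀ m : ℕ, |((L m).length : ℝ) - a * m| ≤ C) : Tendsto (cumLen L) atTop atTop := by
  rw [← tendsto_natCast_atTop_iff (R := ℝ)]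
  refine tendsto_atTop_mono' _ (eventually_sq_le_cumLen L ha hlen) ?_
  refine Tendsto.const_mul_atTop (by positivity) ?_
  exact (tendsto_pow_atTop two_ne_zero).comp
    (tendsto_atTop_add_const_right _ _ tendsto_natCast_atTop_atTop)

lemma exists_cumLen_index (L : ℕ → List α) (h : Tendsto (cumLen L) atTop atTop) :
    ∃ μ : ℕ → ℕ, Tendsto μ atTop atTop ∧
      ∀ n, cumLen L (μ n) ≤ n + 1 ∧ n + 1 < cumLen L (μ n + 1) := by
  have hex : ∀ n, ∃ m, cumLen L m ≤ n + 1 ∧ n + 1 < cumLen L (m + 1) := by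
    intro n
    obtain ⟨M, hM⟩ := (h.eventually_gt_atTop (n + 1)).exists
    induction M with
    | zero => simp [cumLen] at hM
    | succ M ih =>
      by_cases hlt : n + 1 < cumLen L M
      · exact ih hlt
      · exact ⟨M, by omega, hM⟩
  choose μ hμ using hex
  refine ⟨μ, tendsto_atTop.2 fun M => ?_, hμ⟩
  filter_upwards [eventually_ge_atTop (cumLen L M)] with n hn
  by_contra! hlt
  have := cumLen_mono L (show μ n + 1 ≤ M from hlt)
  have := (hμ n).2
  omega

lemma tendsto_slideN_pre_div [DecidableEq α] (d : α) (L : ℕ → List α) {w : List α} (hw : w ≠ [])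
    {a p C : ℝ} (ha : 0 < a) (hlen : ∀ m : ℕ, |((L m).length : ℝ) - a * m| ≤ C)
    (hN : ∀ m : ℕ, |(slideN w (L m) : ℝ) - p * a * m| ≤ C * √(m + 1)) :
    Tendsto (fun n => (slideN w (pre (concatSeq d L) n) : ℝ) / (n + 1)) atTop (𝓝 p) := by
  have hC : 0 ≤ C := (abs_nonneg _).trans (hlen 0)
  obtain ⟨μ, hμ, hμn⟩ := exists_cumLen_index L (tendsto_cumLen_atTop L ha hlen)
  set K : ℝ := (1 + |p|) * (a + 2 * C) + 2 * w.length with hK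
  have hK0 : 0 ≤ K := by positivity
  have hbound : ∀ n, |(slideN w (pre (concatSeq d L) n) : ℝ) - p * (n + 1)| ≤
      K * ((μ n + 1) * √(μ n + 1)) := by
    intro n
    obtain ⟨h1, h2⟩ := hμn n
    generalize μ n = m at h1 h2 ⊢
    have hm0 : (0 : ℝ) ≤ m := Nat.cast_nonneg m
    have hs1 : 1 ≤ √((m : ℝ) + 1) := Real.one_le_sqrt.2 (by linarith)
    have e1 := abs_slideN_pre_sub_le hw (concatSeq d L) n _ h1
    have e2 := abs_slideN_ofFn_concatSeq_sub_le hw d L m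
    have e3 := abs_sum_sub_le hC hN m
    have e4 := abs_cumLen_sub_le L hlen m
    have e5 : ((n : ℝ) + 1 - cumLen L m) ≤ a * m + C := by
      have h2' : (n : ℝ) + 1 < cumLen L m + (L m).length := by exact_mod_cast h2
      linarith [(abs_le.1 (hlen m)).2]
    have e6 : 0 ≤ (n : ℝ) + 1 - cumLen L m := by
      have : (cumLen L m : ℝ) ≤ n + 1 := by exact_mod_cast h1
      linarith
    have e7 : |p * ((n : ℝ) + 1 - a * (m * (m - 1) / 2))| ≤ |p| * (a * m + C + C * m) := by
      rw [abs_mul]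
      refine mul_le_mul_of_nonneg_left ?_ (abs_nonneg p)
      rw [abs_le] at e4 ⊢
      constructor <;> nlinarith
    have e8 : |(slideN w (pre (concatSeq d L) n) : ℝ) - p * (n + 1)| ≤
        (a * m + C + w.length) + m * w.length + C * (m * √(m + 1)) +
          |p| * (a * m + C + C * m) := by
      rw [abs_le] at *
      constructor <;> linarith
    refine e8.trans ?_
    have hM : (m : ℝ) + 1 ≤ (m + 1) * √(m + 1) := le_mul_of_one_le_right (by positivity) hs1
    have hM' : (m : ℝ) * √(m + 1) ≤ (m + 1) * √(m + 1) := by gcongr; linarith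
    calc _ ≤ (a * ((m + 1) * √(m + 1)) + C * ((m + 1) * √(m + 1)) +
          w.length * ((m + 1) * √(m + 1))) + w.length * ((m + 1) * √(m + 1)) +
          C * ((m + 1) * √(m + 1)) +
          |p| * (a * ((m + 1) * √(m + 1)) + C * ((m + 1) * √(m + 1)) +
            C * ((m + 1) * √(m + 1))) := by
          have f1 : (m : ℝ) ≤ (m + 1) * √(m + 1) := by linarith
          have f2 : (1 : ℝ) ≤ (m + 1) * √(m + 1) := by linarith
          have f3 : C ≤ C * ((m + 1) * √((m : ℝ) + 1)) := le_mul_of_one_le_right hC f2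
          have f4 : (w.length : ℝ) ≤ w.length * ((m + 1) * √((m : ℝ) + 1)) :=
            le_mul_of_one_le_right (by positivity) f2
          rw [mul_comm (m : ℝ) (w.length : ℝ)]
          gcongr
      _ = K * ((m + 1) * √(m + 1)) := by rw [hK]; ring
  have hg : Tendsto (fun m : ℕ => K * (4 / a) / √((m : ℝ) + 1)) atTop (𝓝 0) :=
    Tendsto.div_atTop tendsto_const_nhds (Real.tendsto_sqrt_atTop.comp
      (tendsto_atTop_add_const_right _ _ tendsto_natCast_atTop_atTop))
  rw [tendsto_iff_norm_sub_tendsto_zero]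
  refine squeeze_zero' (Eventually.of_forall fun n => norm_nonneg _) ?_ (hg.comp hμ)
  filter_upwards [hμ.eventually (eventually_sq_le_cumLen L ha hlen)] with n hn
  have hn0 : (0 : ℝ) < n + 1 := by positivity
  have h1 : (cumLen L (μ n) : ℝ) ≤ n + 1 := by exact_mod_cast (hμn n).1
  have hsq : √((μ n : ℝ) + 1) * √((μ n : ℝ) + 1) = μ n + 1 := Real.mul_self_sqrt (by positivity)
  have hs0 : 0 < √((μ n : ℝ) + 1) := Real.sqrt_pos.2 (by positivity)
  have hdiv : (slideN w (pre (concatSeq d L) n) : ℝ) / (n + 1) - p =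
      (slideN w (pre (concatSeq d L) n) - p * (n + 1)) / (n + 1) := by field_simp
  rw [hdiv, norm_div, Real.norm_eq_abs, Real.norm_of_nonneg hn0.le, div_le_iff₀ hn0]
  refine (hbound n).trans ?_
  have h2 := hn.trans h1
  simp only [Function.comp_apply]
  calc K * ((μ n + 1) * √(μ n + 1))
      = K * (4 / a) / √((μ n : ℝ) + 1) * (a / 4 * ((μ n + 1) * (√(μ n + 1) * √(μ n + 1)))) := by
        field_simp
    _ ≤ K * (4 / a) / √((μ n : ℝ) + 1) * (n + 1) := by
        refine mul_le_mul_of_nonneg_left ?_ (by positivity)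
        rwa [hsq, ← sq]

lemma tendsto_slideP_pre [DecidableEq α] (S : ℕ → α) (w : List α) {p : ℝ}
    (h : Tendsto (fun n => (slideN w (pre S n) : ℝ) / (n + 1)) atTop (𝓝 p)) :
    Tendsto (fun n => slideP w (pre S n)) atTop (𝓝 p) := by
  have h0 : Tendsto (fun n : ℕ => (n : ℝ) + 1) atTop atTop :=
    tendsto_atTop_add_const_right _ _ tendsto_natCast_atTop_atTop
  have h1 : Tendsto (fun n : ℕ => 1 - ((w.length : ℝ) - 1) / ((n : ℝ) + 1)) atTop (𝓝 1) := by
    simpa using tendsto_const_nhds.sub (Tendsto.div_atTop tendsto_const_nhds h0)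
  have h2 := h.div h1 one_ne_zero
  rw [div_one] at h2
  refine h2.congr fun n => ?_
  have hn : ((n : ℝ) + 1) ≠ 0 := by positivity
  simp only [slideP, pre, List.length_ofFn, Pi.div_apply]
  rw [div_div, mul_sub, mul_one, mul_div_cancel₀ _ hn]
  push_cast
  congr 1
  ring

end Frequencies

section Entropy

open Filter Topology

lemma mul_logb_inv (c x : ℝ) : x * Real.logb c x⁻¹ = Real.negMulLog x / Real.log c := by
  simp [Real.logb, Real.negMulLog, neg_div, mul_div_assoc]

lemma dimFS_eq_and_DimFS_eq {α : Type*} [Fintype α] [DecidableEq α] (S : ℕ → α) {s : ℝ}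
    (h : ℕ → ℝ) (hS : ∀ l, Tendsto (fun n => slideH (l + 1) (pre S n)) atTop (𝓝 (h l)))
    (hle : ∀ l, s ≤ h l) (hlim : Tendsto h atTop (𝓝 s)) : dimFS S = s ∧ DimFS S = s := by
  have hinf : ⨅ l, h l = s :=
    le_antisymm (ge_of_tendsto' hlim fun l => ciInf_le ⟨s, by rintro _ ⟨l, rfl⟩; exact hle l⟩ l)
      (le_ciInf hle)
  exact ⟨by simp only [dimFS, (hS _).liminf_eq, hinf], by simp only [DimFS, (hS _).limsup_eq, hinf]⟩

lemma tendsto_slideH_pre {α : Type*} [Fintype α] [DecidableEq α] (S : ℕ → α) (l : ℕ)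
    (p : (Fin l → α) → ℝ)
    (h : ∀ v, Tendsto (fun n => slideP (List.ofFn v) (pre S n)) atTop (𝓝 (p v))) :
    Tendsto (fun n => slideH l (pre S n)) atTop
      (𝓝 (1 / l * ∑ v, Real.negMulLog (p v) / Real.log (Fintype.card α))) := by
  simp only [slideH, mul_logb_inv]
  exact (tendsto_finsetSum _ fun v _ =>
    ((Real.continuous_negMulLog.tendsto _).comp (h v)).div_const _).const_mul _

/-- The probability of a word `v` under the mixture of the uniform distribution with weight `s`
and the point mass at the constant word `z` with weight `1 - s`. -/
noncomputable def mixProb {α : Type*} [Fintype α] [DecidableEq α] (s : ℝ) (z : α)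
    (v : List α) : ℝ :=
  s * ((Fintype.card α : ℝ) ^ v.length)⁻¹ + (1 - s) * if v = List.replicate v.length z then 1 else 0

lemma sum_negMulLog_mixProb_bounds {α : Type*} [Fintype α] [DecidableEq α] (z : α) {s : ℝ}
    (hs : s ∈ Set.Icc (0 : ℝ) 1) (l : ℕ) :
    s * (l * Real.log (Fintype.card α)) ≤
        ∑ v : Fin l → α, Real.negMulLog (mixProb s z (List.ofFn v)) ∧
      ∑ v : Fin l → α, Real.negMulLog (mixProb s z (List.ofFn v)) ≤
        s * (l * Real.log (Fintype.card α)) + 2 := by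
  classical
  obtain ⟨hs0, hs1⟩ := hs
  have hcard : (1 : ℝ) ≤ Fintype.card α := by
    exact_mod_cast Fintype.card_pos_iff.2 ⟨z⟩
  set B : ℝ := (Fintype.card α : ℝ) ^ l with hB
  have hB1 : 1 ≤ B := one_le_pow₀ hcard
  have hB0 : 0 < B := by linarith
  have hlogB : Real.log B = l * Real.log (Fintype.card α) := by rw [hB, Real.log_pow]
  have hq : Real.negMulLog B⁻¹ = B⁻¹ * Real.log B := by simp [Real.negMulLog]
  have hcount : ∑ _v : Fin l → α, B⁻¹ = 1 := by
    simp [hB, mul_inv_cancel₀ (show (Fintype.card α : ℝ) ^ l ≠ 0 by positivity)]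
  have hval : ∀ v : Fin l → α, mixProb s z (List.ofFn v) =
      s * B⁻¹ + (1 - s) * if v = fun _ => z then 1 else 0 := by
    intro v
    have : List.ofFn v = List.replicate l z ↔ v = fun _ => z := by
      rw [← List.ofFn_const, List.ofFn_inj]
    simp only [mixProb, List.length_ofFn, this, hB]
  simp only [hval, ← hlogB]
  have hqmem : B⁻¹ ∈ Set.Ici (0 : ℝ) := by simp [hB0.le]
  constructor
  · calc s * Real.log B = ∑ _v : Fin l → α, s * Real.negMulLog B⁻¹ := by
          rw [hq, ← Finset.mul_sum, ← Finset.sum_mul, hcount, one_mul]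
      _ ≤ _ := by
          refine Finset.sum_le_sum fun v _ => ?_
          have hconc := Real.concaveOn_negMulLog.2 hqmem
            (show (if v = fun _ => z then (1 : ℝ) else 0) ∈ Set.Ici (0 : ℝ) by
              split_ifs <;> simp) hs0 (sub_nonneg.2 hs1) (by ring)
          simp only [smul_eq_mul] at hconc
          refine le_trans (le_of_eq ?_) hconc
          split_ifs <;> simp
  · have hterm : ∀ v : Fin l → α,
        Real.negMulLog (s * B⁻¹ + (1 - s) * if v = fun _ => z then 1 else 0) ≤
          s * (B⁻¹ * Real.log B) + B⁻¹ + if v = fun _ => z then 1 else 0 := by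
      intro v
      have hB' : 0 < B⁻¹ := inv_pos.2 hB0
      have hlog : 0 ≤ Real.log B := Real.log_nonneg hB1
      split_ifs with hv
      · have h0 : 0 ≤ s * B⁻¹ + (1 - s) * 1 := by
          have := mul_nonneg hs0 hB'.le
          linarith
        have := Real.negMulLog_le_one_sub_self h0
        have : 0 ≤ s * (B⁻¹ * Real.log B) := by positivity
        linarith
      · rw [mul_zero, add_zero, add_zero, Real.negMulLog_mul, hq]
        have h1 : B⁻¹ * Real.negMulLog s ≤ B⁻¹ * 1 :=
          mul_le_mul_of_nonneg_left
            ((Real.negMulLog_le_one_sub_self hs0).trans (by linarith)) hB'.le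
        linarith
    refine (Finset.sum_le_sum fun v _ => hterm v).trans (le_of_eq ?_)
    rw [Finset.sum_add_distrib, Finset.sum_add_distrib, hcount, ← Finset.mul_sum,
      ← Finset.sum_mul, hcount, Finset.sum_ite_eq' Finset.univ]
    simp
    ring

lemma dimFS_eq_and_DimFS_eq_of_mixProb {α : Type*} [Fintype α] [DecidableEq α]
    (hα : 2 ≤ Fintype.card α) (S : ℕ → α) (z : α) {s : ℝ} (hs : s ∈ Set.Icc (0 : ℝ) 1)
    (h : ∀ w : List α, w ≠ [] →
      Tendsto (fun n => slideP w (pre S n)) atTop (𝓝 (mixProb s z w))) :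
    dimFS S = s ∧ DimFS S = s := by
  have hlog : 0 < Real.log (Fintype.card α) :=
    Real.log_pos (by exact_mod_cast hα)
  have hbounds : ∀ l : ℕ,
      s ≤ 1 / ((l + 1 : ℕ) : ℝ) * ∑ v : Fin (l + 1) → α,
        Real.negMulLog (mixProb s z (List.ofFn v)) / Real.log (Fintype.card α) ∧
      1 / ((l + 1 : ℕ) : ℝ) * ∑ v : Fin (l + 1) → α,
        Real.negMulLog (mixProb s z (List.ofFn v)) / Real.log (Fintype.card α) ≤
        s + 2 / Real.log (Fintype.card α) / ((l : ℝ) + 1) := by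
    intro l
    obtain ⟨h1, h2⟩ := sum_negMulLog_mixProb_bounds z hs (l + 1)
    have hl : (0 : ℝ) < ((l + 1 : ℕ) : ℝ) := by positivity
    rw [← Finset.sum_div, one_div, ← div_eq_inv_mul, div_div, le_div_iff₀ (by positivity),
      div_le_iff₀ (by positivity)]
    constructor
    · linarith
    · refine h2.trans (le_of_eq ?_)
      push_cast
      field_simp
  refine dimFS_eq_and_DimFS_eq S _
    (fun l => tendsto_slideH_pre S (l + 1) _ fun v => h _ (by simp)) (fun l => (hbounds l).1) ?_
  refine tendsto_of_tendsto_of_tendsto_of_le_of_le tendsto_const_nhds ?_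
    (fun l => (hbounds l).1) (fun l => (hbounds l).2)
  simpa using tendsto_const_nhds.add (Tendsto.div_atTop
    (tendsto_const_nhds (x := 2 / Real.log (Fintype.card α)))
    (tendsto_atTop_add_const_right atTop (1 : ℝ) tendsto_natCast_atTop_atTop))

end Entropy

section MainConstruction

variable {b : ℕ} (hb : 0 < b)

lemma abs_slideN_replicate_sub_le {α : Type*} [DecidableEq α] (w : List α) (a : α) (z : ℕ) :
    |(slideN w (List.replicate z a) : ℝ) -
      (if w = List.replicate w.length a then 1 else 0) * z| ≤ 1 + w.length := by
  split_ifs with h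
  · have h1 : ((z + 1 - w.length : ℕ) : ℝ) ≤ z + 1 := by exact_mod_cast Nat.sub_le _ _
    have h2 : (z : ℝ) + 1 ≤ (z + 1 - w.length : ℕ) + w.length := by
      exact_mod_cast le_tsub_add
    rw [slideN_replicate_self w a z h, abs_le]
    constructor <;> linarith [(Nat.cast_nonneg w.length : (0 : ℝ) ≤ w.length)]
  · rw [slideN_replicate_of_ne w a z h]
    simp only [Nat.cast_zero, zero_mul, sub_zero, abs_zero]
    positivity

/-- If the number of occurrences of `w` in `u` is close to `a κ / b ^ |w|`, and `u` is padded by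
`a (m - κ)` zeros with `κ ≈ s m`, then the occurrences of `w` are close to `mixProb s 0 w * a * m`. -/
lemma abs_slideN_append_replicate_sub_le {w : List (Fin b)} (hw : w ≠ []) (u : List (Fin b))
    {s C : ℝ} (hC : 0 ≤ C) {a κ m : ℕ} (hκm : κ ≤ m) (hκ : |(κ : ℝ) - s * m| ≤ 1)
    (hu : |(slideN w u : ℝ) - a * κ * ((b : ℝ) ^ w.length)⁻¹| ≤ C * √(κ + 1)) :
    |(slideN w (u ++ List.replicate (a * (m - κ)) ⟨0, hb⟩) : ℝ) -
      mixProb s (⟨0, hb⟩ : Fin b) w * a * m| ≤ (C + 2 * w.length + 1 + 2 * a) * √(m + 1) := by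
  have h1 := abs_slideN_append_sub_le hw u (List.replicate (a * (m - κ)) ⟨0, hb⟩)
  have h2 := abs_slideN_replicate_sub_le w (⟨0, hb⟩ : Fin b) (a * (m - κ))
  unfold mixProb
  rw [Fintype.card_fin]
  set q : ℝ := ((b : ℝ) ^ w.length)⁻¹
  set δ : ℝ := if w = List.replicate w.length (⟨0, hb⟩ : Fin b) then 1 else 0 with hδ
  have hq0 : 0 ≤ q := by positivity
  have hq1 : q ≤ 1 := inv_le_one_of_one_le₀ (one_le_pow₀ (by exact_mod_cast hb))
  have hδ01 : 0 ≤ δ ∧ δ ≤ 1 := by rw [hδ]; split_ifs <;> norm_num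
  have hs1 : 1 ≤ √((m : ℝ) + 1) := Real.one_le_sqrt.2 (by
    linarith [(Nat.cast_nonneg m : (0 : ℝ) ≤ m)])
  have h3 : C * √((κ : ℝ) + 1) ≤ C * √(m + 1) := by gcongr
  have h4 : |(a : ℝ) * (q - δ) * (κ - s * m)| ≤ a := by
    rw [abs_mul, abs_mul, Nat.abs_cast]
    have : |q - δ| ≤ 1 := by rw [abs_le]; constructor <;> linarith [hδ01.1, hδ01.2]
    calc (a : ℝ) * |q - δ| * |κ - s * m| ≤ a * 1 * 1 := by gcongr
      _ = a := by ring
  have h5 : (2 * w.length + 1 + a : ℝ) ≤ (2 * w.length + 1 + 2 * a) * √(m + 1) :=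
    (le_mul_of_one_le_right (by positivity) hs1).trans' (by
      linarith [(Nat.cast_nonneg a : (0 : ℝ) ≤ a)])
  push_cast [Nat.cast_sub hκm] at h1 h2
  rw [abs_le] at *
  constructor <;> linarith

/-- A number with about `s * m` digits taken from a normal number, followed by zeros. -/
noncomputable def paddedNormal (b : ℕ) (X : ℕ → ℕ) (s : ℝ) (m : ℕ) : ℕ :=
  X ⌊s * m⌋₊ * b ^ (m - ⌊s * m⌋₊)

lemma floor_mul_le {s : ℝ} (hs : s ∈ Set.Icc (0 : ℝ) 1) (m : ℕ) : ⌊s * m⌋₊ ≤ m :=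
  Nat.floor_le_of_le (mul_le_of_le_one_left (Nat.cast_nonneg m) hs.2)

lemma abs_floor_sub_le {s : ℝ} (hs : s ∈ Set.Icc (0 : ℝ) 1) (m : ℕ) :
    |(⌊s * m⌋₊ : ℝ) - s * m| ≤ 1 := by
  have h0 : 0 ≤ s * m := mul_nonneg hs.1 (Nat.cast_nonneg m)
  rw [abs_le]
  constructor <;> linarith [Nat.floor_le h0, Nat.lt_floor_add_one (s * m)]

lemma paddedNormal_bounds {X : ℕ → ℕ} (hb : 0 < b)
    (hX : ∀ m, b ^ (m + 2) ≤ X m ∧ X m < b ^ (m + 3)) {s : ℝ} (hs : s ∈ Set.Icc (0 : ℝ) 1)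
    (m : ℕ) : b ^ (m + 2) ≤ paddedNormal b X s m ∧ paddedNormal b X s m < b ^ (m + 3) := by
  have hκ := floor_mul_le hs m
  unfold paddedNormal
  obtain ⟨h1, h2⟩ := hX ⌊s * m⌋₊
  generalize ⌊s * m⌋₊ = κ at *
  obtain ⟨r, rfl⟩ := Nat.exists_eq_add_of_le hκ
  rw [Nat.add_sub_cancel_left]
  constructor
  · calc b ^ (κ + r + 2) = b ^ (κ + 2) * b ^ r := by ring
      _ ≤ _ := Nat.mul_le_mul_right _ h1
  · calc _ < b ^ (κ + 3) * b ^ r := Nat.mul_lt_mul_of_pos_right h2 (by positivity)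
      _ = _ := by ring

lemma CEseqF_sq (A : Set ℕ) :
    CEseqF b hb A (fun n => (n : ℝ) ^ 2) =
      concatSeq ⟨0, hb⟩ (fun i => digitsFin b hb (Nat.nth (· ∈ A) i ^ 2)) := by
  unfold CEseqF
  congr 1
  funext i
  simp only [← Nat.cast_pow, Nat.floor_natCast]

lemma nth_mem_range {f : ℕ → ℕ} (hf : StrictMono f) (m : ℕ) :
    Nat.nth (· ∈ Set.range f) m = f m := by
  have hinf : (Set.ofPred (· ∈ Set.range f)).Infinite := Set.infinite_range_of_injective hf.injective
  exact congrFun ((Nat.nth_strictMono hinf).range_inj hf |>.1 (Nat.range_nth_of_infinite hinf)) m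

end MainConstruction

/-- For every `s ∈ [0,1]` and every base `b ≥ 2` there is an
infinite set `A ⊆ ℕ` such that, with `p(x) = x²`,
`dim_FS(CE_b(A)) = Dim_FS(CE_b(A)) = dim_FS(CE_b(p(A))) = Dim_FS(CE_b(p(A))) = s`. -/
theorem stmt12 (s : ℝ) (hs : s ∈ Set.Icc (0 : ℝ) 1) (b : ℕ) (hb : 2 ≤ b) :
    ∃ A : Set ℕ, A.Infinite ∧
      dimFS (CEseq b (by omega) A) = s ∧
      DimFS (CEseq b (by omega) A) = s ∧
      dimFS (CEseqF b (by omega) A (fun n => (n : ℝ) ^ 2)) = s ∧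
      DimFS (CEseqF b (by omega) A (fun n => (n : ℝ) ^ 2)) = s := by
  have hb0 : 0 < b := by omega
  obtain ⟨X, hX, hfreq⟩ := exists_normal_and_sq_normal hb0 hb
  have hbounds := paddedNormal_bounds hb0 hX hs
  have hmono : StrictMono (paddedNormal b X s) :=
    strictMono_nat_of_lt_succ fun m => (hbounds m).2.trans_le (hbounds (m + 1)).1
  have hX0 : ∀ k, 0 < X k := fun k => lt_of_lt_of_le (by positivity) (hX k).1
  refine ⟨Set.range (paddedNormal b X s), Set.infinite_range_of_injective hmono.injective, ?_⟩
  have hcard : 2 ≤ Fintype.card (Fin b) := by simpa using hb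
  rw [← and_assoc]
  constructor
  · refine dimFS_eq_and_DimFS_eq_of_mixProb hcard _ ⟨0, hb0⟩ hs fun w hw => ?_
    apply tendsto_slideP_pre
    obtain ⟨C, hC, hfw⟩ := hfreq w hw
    simp only [CEseq, nth_mem_range hmono]
    refine tendsto_slideN_pre_div _ _ hw (a := 1) (C := C + 2 * w.length + 1 + 2 * (1 : ℕ) + 3)
      one_pos (fun m => ?_) fun m => ?_
    · have h1 := lt_length_digitsFin hb0 hb (hbounds m).1
      have h2 := length_digitsFin_le hb0 hb (hbounds m).2
      have h1' : (m : ℝ) + 2 < (digitsFin b hb0 (paddedNormal b X s m)).length := by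
        exact_mod_cast h1
      have h2' : ((digitsFin b hb0 (paddedNormal b X s m)).length : ℝ) ≤ m + 3 := by
        exact_mod_cast h2
      push_cast
      rw [abs_le]
      constructor <;> linarith [(Nat.cast_nonneg w.length : (0 : ℝ) ≤ w.length)]
    · have h := abs_slideN_append_replicate_sub_le hb0 hw (a := 1) _ hC (floor_mul_le hs m)
        (abs_floor_sub_le hs m) (by simpa using (hfw ⌊s * m⌋₊).1)
      rw [one_mul, ← digitsFin_mul_pow hb0 hb (hX0 _)] at h
      rw [Nat.cast_one] at h ⊢
      refine h.trans (mul_le_mul_of_nonneg_right (by linarith) (Real.sqrt_nonneg _))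
  · refine dimFS_eq_and_DimFS_eq_of_mixProb hcard _ ⟨0, hb0⟩ hs fun w hw => ?_
    apply tendsto_slideP_pre
    obtain ⟨C, hC, hfw⟩ := hfreq w hw
    simp only [CEseqF_sq, nth_mem_range hmono]
    refine tendsto_slideN_pre_div _ _ hw (a := 2) (C := C + 2 * w.length + 1 + 2 * (2 : ℕ) + 6)
      two_pos (fun m => ?_) fun m => ?_
    · have h1 := lt_length_digitsFin hb0 hb (k := 2 * m + 4) (n := paddedNormal b X s m ^ 2) (by
        calc b ^ (2 * m + 4) = (b ^ (m + 2)) ^ 2 := by ring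
          _ ≤ _ := Nat.pow_le_pow_left (hbounds m).1 2)
      have h2 := length_digitsFin_le hb0 hb (k := 2 * m + 6) (n := paddedNormal b X s m ^ 2) (by
        calc _ < (b ^ (m + 3)) ^ 2 := Nat.pow_lt_pow_left (hbounds m).2 two_ne_zero
          _ = _ := by ring)
      have h1' : 2 * (m : ℝ) + 4 < (digitsFin b hb0 (paddedNormal b X s m ^ 2)).length := by
        exact_mod_cast h1
      have h2' : ((digitsFin b hb0 (paddedNormal b X s m ^ 2)).length : ℝ) ≤ 2 * m + 6 := by
        exact_mod_cast h2
      push_cast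
      rw [abs_le]
      constructor <;> linarith [(Nat.cast_nonneg w.length : (0 : ℝ) ≤ w.length)]
    · have h := abs_slideN_append_replicate_sub_le hb0 hw (a := 2) _ hC (floor_mul_le hs m)
        (abs_floor_sub_le hs m) (by simpa using (hfw ⌊s * m⌋₊).2)
      rw [← digitsFin_mul_pow hb0 hb (pow_pos (hX0 _) 2), mul_comm 2 (m - _), pow_mul,
        ← mul_pow] at h
      rw [Nat.cast_ofNat] at h ⊢
      refine h.trans (mul_le_mul_of_nonneg_right (by linarith) (Real.sqrt_nonneg _))
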